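/- arXiv:math/0701687 — 2 statements merged into one kernel-verified Lean document; each statement's English description precedes it below -/
import Mathlib

section
/- For every μ ∈ (0, μ̄), the function ξ(s) = (p−1)s^p − (N−(a+1)p)s^{p−1} + μ has exactly two zeros l₁, l₂ on (0, +∞), and they satisfy 0 < l₁ < δ < l₂, where δ = (N−(a+1)p)/p. -/
open Set

noncomputable section

/-- The function `s ↦ (p - 1) s ^ p - p δ s ^ (p - 1) + μ`. -/
def xi (p δ μ s : ℝ) : ℝ := (p - 1) * s ^ p - p * δ * s ^ (p - 1) + μ

lemma continuous_xi {p : ℝ} (hp : 1 < p) (δ μ : ℝ) : Continuous (xi p δ μ) := by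
  have h₁ : Continuous fun s : ℝ => s ^ p := Real.continuous_rpow_const (by linarith)
  have h₂ : Continuous fun s : ℝ => s ^ (p - 1) := Real.continuous_rpow_const (by linarith)
  unfold xi
  fun_prop

lemma deriv_xi {s : ℝ} (hs : 0 < s) (p δ μ : ℝ) :
    deriv (xi p δ μ) s = p * (p - 1) * s ^ (p - 1 - 1) * (s - δ) := by
  have h := (((Real.hasDerivAt_rpow_const (p := p) (Or.inl hs.ne')).const_mul (p - 1)).sub
    ((Real.hasDerivAt_rpow_const (p := p - 1) (Or.inl hs.ne')).const_mul (p * δ))).add_const μ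
  refine HasDerivAt.deriv (f := xi p δ μ) (h.congr_deriv ?_)
  rw [Real.rpow_sub_one hs.ne' (p - 1)]
  field_simp

lemma xi_zero {p : ℝ} (hp : 1 < p) (δ μ : ℝ) : xi p δ μ 0 = μ := by
  simp [xi, Real.zero_rpow (by linarith : p ≠ 0), Real.zero_rpow (by linarith : p - 1 ≠ 0)]

lemma xi_eq_rpow_mul {s : ℝ} (hs : 0 < s) (p δ μ : ℝ) :
    xi p δ μ s = s ^ (p - 1) * ((p - 1) * s - p * δ) + μ := by
  have h : s ^ p = s ^ (p - 1) * s := by rw [Real.rpow_sub_one hs.ne', div_mul_cancel₀ _ hs.ne']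
  rw [xi, h]
  ring

lemma xi_self {δ : ℝ} (hδ : 0 < δ) (p μ : ℝ) : xi p δ μ δ = μ - δ ^ p := by
  rw [xi_eq_rpow_mul hδ, Real.rpow_sub_one hδ.ne']
  field_simp
  ring

lemma strictAntiOn_xi {p : ℝ} (hp : 1 < p) (δ μ : ℝ) : StrictAntiOn (xi p δ μ) (Icc 0 δ) := by
  refine strictAntiOn_of_deriv_neg (convex_Icc 0 δ) (continuous_xi hp δ μ).continuousOn ?_
  intro s hs
  rw [interior_Icc] at hs
  rw [deriv_xi hs.1]
  have := Real.rpow_pos_of_pos hs.1 (p - 1 - 1)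
  have : 0 < p - 1 := by linarith
  exact mul_neg_of_pos_of_neg (by positivity) (by linarith [hs.2])

lemma strictMonoOn_xi {p δ : ℝ} (hp : 1 < p) (hδ : 0 < δ) (μ : ℝ) :
    StrictMonoOn (xi p δ μ) (Ici δ) := by
  refine strictMonoOn_of_deriv_pos (convex_Ici δ) (continuous_xi hp δ μ).continuousOn ?_
  intro s hs
  rw [interior_Ici, mem_Ioi] at hs
  have hs₀ : 0 < s := hδ.trans hs
  rw [deriv_xi hs₀]
  have : 0 < p - 1 := by linarith
  have : 0 < s - δ := by linarith
  positivity

/-- for `μ ∈ (0, μ̄)` the function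
`ξ(s) = (p−1)s^p − (N−(a+1)p)s^{p−1} + μ` has exactly two zeros `l₁ < l₂` on `(0,∞)`,
and `0 < l₁ < δ < l₂` where `δ = (N−(a+1)p)/p`. -/
theorem xi_has_exactly_two_zeros (N : ℕ) (p a δ μ : ℝ)
    (hp : 1 < p) (hpN : p < N) (ha : 0 ≤ a) (ha' : a < ((N : ℝ) - p) / p)
    (hδ : δ = ((N : ℝ) - (a + 1) * p) / p)
    (hμ : 0 < μ) (hμ' : μ < δ ^ p) :
    ∃ l₁ l₂ : ℝ, 0 < l₁ ∧ l₁ < δ ∧ δ < l₂ ∧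
      (p - 1) * l₁ ^ p - ((N : ℝ) - (a + 1) * p) * l₁ ^ (p - 1) + μ = 0 ∧
      (p - 1) * l₂ ^ p - ((N : ℝ) - (a + 1) * p) * l₂ ^ (p - 1) + μ = 0 ∧
      ∀ s ∈ Ioi (0 : ℝ),
        (p - 1) * s ^ p - ((N : ℝ) - (a + 1) * p) * s ^ (p - 1) + μ = 0 →
        s = l₁ ∨ s = l₂ := by
  have hp₀ : 0 < p := by linarith
  have hp₁ : 0 < p - 1 := by linarith
  have hδ₀ : 0 < δ := by
    rw [lt_div_iff₀ hp₀] at ha'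
    rw [hδ]
    exact div_pos (by linarith) hp₀
  have hcoeff : (N : ℝ) - (a + 1) * p = p * δ := by rw [hδ]; field_simp
  rw [hcoeff]
  have hneg : xi p δ μ δ < 0 := by rw [xi_self hδ₀]; linarith
  have hT : δ < p * δ / (p - 1) := by rw [lt_div_iff₀ hp₁]; linarith
  have hpos : 0 < xi p δ μ (p * δ / (p - 1)) := by
    rwa [xi_eq_rpow_mul (hδ₀.trans hT), mul_div_cancel₀ _ hp₁.ne', sub_self, mul_zero, zero_add]
  have hcont := continuous_xi hp δ μ
  obtain ⟨l₁, ⟨hl₁, hl₁'⟩, h₁⟩ := intermediate_value_Ioo' hδ₀.le hcont.continuousOn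
    ⟨hneg, (xi_zero hp δ μ).symm ▸ hμ⟩
  obtain ⟨l₂, ⟨hl₂, -⟩, h₂⟩ := intermediate_value_Ioo hT.le hcont.continuousOn ⟨hneg, hpos⟩
  refine ⟨l₁, l₂, hl₁, hl₁', hl₂, h₁, h₂, fun s hs h => ?_⟩
  change xi p δ μ s = 0 at h
  rcases le_total s δ with hsδ | hsδ
  · exact Or.inl ((strictAntiOn_xi hp δ μ).injOn ⟨(mem_Ioi.1 hs).le, hsδ⟩ ⟨hl₁.le, hl₁'.le⟩
      (h.trans h₁.symm))
  · exact Or.inr ((strictMonoOn_xi hp hδ₀ μ).injOn hsδ hl₂.le (h.trans h₂.symm))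
end
end

section
/- (Lemma 3.1) Let u ∈ 𝔇 be a positive radial solution of (r^{N−1−ap}|u'|^{p−2}u')' + r^{N−1}( μ u^{p−1} r^{−(a+1)p} + u^{p_*−1} r^{−bp_*} ) = 0 on (0,∞), and set t = log r, y(t) = r^δ u(r), z(t) = r^{(1+δ)(p−1)} |u'(r)|^{p−2} u'(r). Then the functions y and z are bounded on ℝ. -/
open MeasureTheory Filter Topology Set

noncomputable section

/-- Membership in `𝔇_{a,b}^{1,p}(ℝ^N)`, the closure of `C_c^∞(ℝ^N)` under the norm
`u ↦ (∫ |∇u|^p |x|^{-ap})^{1/p}`. -/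
def MemD (N : ℕ) (p a : ℝ) (u : EuclideanSpace ℝ (Fin N) → ℝ) : Prop :=
  ∃ φ : ℕ → EuclideanSpace ℝ (Fin N) → ℝ,
    (∀ n, ContDiff ℝ (⊤ : ℕ∞) (φ n) ∧ HasCompactSupport (φ n)) ∧
    Tendsto
      (fun n => ∫ x : EuclideanSpace ℝ (Fin N),
        ‖fderiv ℝ (fun y => u y - φ n y) x‖ ^ p / ‖x‖ ^ (a * p)) atTop (𝓝 0)

/-- `y(t) = r^δ u(r)` with `r = e^t`. -/
def yf (u : ℝ → ℝ) (δ t : ℝ) : ℝ := Real.exp (δ * t) * u (Real.exp t)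

/-- `z(t) = r^{(1+δ)(p−1)} |u'(r)|^{p−2} u'(r)` with `r = e^t`. -/
def zf (u : ℝ → ℝ) (δ p t : ℝ) : ℝ :=
  Real.exp ((1 + δ) * (p - 1) * t) * |deriv u (Real.exp t)| ^ (p - 2) * deriv u (Real.exp t)

/-- If `x ^ β ≤ A + B * x ^ α` with `α < β`, then `x` is bounded in terms of `A`, `B`, `α`, `β`. -/
theorem le_max_of_rpow_le_add_mul_rpow {x A B α β : ℝ} (hA : 0 ≤ A) (hα : 0 ≤ α) (hαβ : α < β)
    (h : x ^ β ≤ A + B * x ^ α) : x ≤ max 1 ((A + B) ^ (β - α)⁻¹) := by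
  rcases le_total x 1 with hx1 | hx1
  · exact hx1.trans (le_max_left _ _)
  · refine le_max_of_le_right ?_
    have hx0 : 0 < x := by linarith
    have h1 : 1 ≤ x ^ α := Real.one_le_rpow hx1 hα
    have h2 : x ^ (β - α) ≤ A + B := by
      rw [Real.rpow_sub hx0, div_le_iff₀ (by positivity)]
      nlinarith
    calc x = (x ^ (β - α)) ^ (β - α)⁻¹ := (Real.rpow_rpow_inv hx0.le (sub_pos.2 hαβ).ne').symm
      _ ≤ _ := Real.rpow_le_rpow (by positivity) h2 (by
        have := sub_pos.2 hαβ
        positivity)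

/-- The map `z ↦ |z| ^ (p' - 2) * z`, with `p' = p / (p - 1)`, inverts `d ↦ |d| ^ (p - 2) * d`. -/
theorem abs_rpow_conj_sub_two_mul {p : ℝ} (hp : 1 < p) (k d : ℝ) :
    |Real.exp (k * (p - 1)) * |d| ^ (p - 2) * d| ^ (p / (p - 1) - 2) *
      (Real.exp (k * (p - 1)) * |d| ^ (p - 2) * d) = Real.exp k * d := by
  rcases eq_or_ne d 0 with rfl | hd
  · simp
  have hp1 : p - 1 ≠ 0 := by linarith
  have hd' : 0 < |d| := abs_pos.2 hd
  have h1 : |Real.exp (k * (p - 1)) * |d| ^ (p - 2) * d|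
      = Real.exp (k * (p - 1)) * |d| ^ (p - 1) := by
    rw [abs_mul, abs_mul, abs_of_pos (Real.exp_pos _), abs_of_pos (Real.rpow_pos_of_pos hd' _),
      mul_assoc, ← Real.rpow_add_one hd'.ne']
    ring_nf
  rw [h1, Real.mul_rpow (Real.exp_pos _).le (by positivity), ← Real.exp_mul, ← Real.rpow_mul hd'.le]
  have h2 : Real.exp (k * (p - 1) * (p / (p - 1) - 2)) * Real.exp (k * (p - 1)) = Real.exp k := by
    rw [← Real.exp_add]
    congr 1
    field_simp
    ring
  have h3 : |d| ^ ((p - 1) * (p / (p - 1) - 2)) * |d| ^ (p - 2) = 1 := by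
    rw [← Real.rpow_add hd', show (p - 1) * (p / (p - 1) - 2) + (p - 2) = 0 by field_simp; ring,
      Real.rpow_zero]
  linear_combination (|d| ^ ((p - 1) * (p / (p - 1) - 2)) * |d| ^ (p - 2) * d) * h2 +
    Real.exp k * d * h3

/-- The Hamiltonian of the autonomous system `y' = δ y + |z| ^ ((2 - p) / (p - 1)) z`,
`z' = - δ z - y ^ (ps - 1) - μ y ^ (p - 1)`. -/
def hamiltonian (p μ ps δ y z : ℝ) : ℝ :=
  δ * y * z + |z| ^ (p / (p - 1)) / (p / (p - 1)) + y ^ ps / ps + μ * y ^ p / p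

theorem hasDerivAt_hamiltonian {p μ ps δ s t : ℝ} {y z : ℝ → ℝ} (hp : 1 < p) (hps : ps ≠ 0)
    (hy0 : y t ≠ 0) (hy : HasDerivAt y (δ * y t + s) t)
    (hz : HasDerivAt z (-δ * z t - y t ^ (ps - 1) - μ * y t ^ (p - 1)) t)
    (hs : |z t| ^ (p / (p - 1) - 2) * z t = s) :
    HasDerivAt (fun t => hamiltonian p μ ps δ (y t) (z t)) 0 t := by
  have hq : 1 < p / (p - 1) := by
    rw [lt_div_iff₀ (by linarith)]
    linarith
  have h1 := ((hasDerivAt_abs_rpow (z t) hq).comp t hz).div_const (p / (p - 1))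
  have h2 := (hy.rpow_const (p := ps) (Or.inl hy0)).div_const ps
  have h3 := ((hy.rpow_const (p := p) (Or.inl hy0)).const_mul μ).div_const p
  refine (((((hy.const_mul δ).mul hz).add h1).add h2).add h3).congr_deriv ?_
  have hp0 : p ≠ 0 := by linarith
  have hq0 : p / (p - 1) ≠ 0 := by linarith
  generalize p / (p - 1) = q at *
  rw [← hs]
  field_simp
  ring

theorem exists_bound_of_hamiltonian_eq {p μ ps δ : ℝ} (hp : 1 < p) (hps : p < ps) (hδ : 0 < δ)
    (hμ : 0 < μ) (E : ℝ) :
    ∃ M : ℝ, ∀ y z : ℝ, 0 ≤ y → hamiltonian p μ ps δ y z = E → |y| ≤ M ∧ |z| ≤ M := by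
  have hp1 : 0 < p - 1 := by linarith
  have hpq : p.HolderConjugate (p / (p - 1)) := Real.HolderConjugate.conjExponent hp
  have hq : 1 < p / (p - 1) := hpq.symm.lt
  unfold hamiltonian
  generalize p / (p - 1) = q at *
  have hps0 : 0 < ps := by linarith
  set Y := max 1 ((ps * |E| + ps * (δ ^ p / p)) ^ (ps - p)⁻¹) with hY
  have hY0 : 0 < Y := lt_max_of_lt_left one_pos
  refine ⟨max Y (max 1 ((q * |E| + q * (δ * Y)) ^ (q - 1)⁻¹)), fun y z hy h => ?_⟩
  have hE := le_abs_self E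
  have hyz : -(δ * y * z) ≤ δ * y * |z| := by
    rw [← mul_neg]
    exact mul_le_mul_of_nonneg_left (neg_le_abs z) (by positivity)
  have hμp : 0 ≤ μ * y ^ p / p := by positivity
  have hyps : 0 ≤ y ^ ps / ps := by positivity
  have hyY : y ≤ Y := by
    refine le_max_of_rpow_le_add_mul_rpow (by positivity) (by linarith) hps ?_
    have young := Real.young_inequality_of_nonneg (mul_nonneg hδ.le hy) (abs_nonneg z) hpq
    rw [Real.mul_rpow hδ.le hy] at young
    have h1 : y ^ ps / ps ≤ |E| + δ ^ p * y ^ p / p := by linarith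
    rw [div_le_iff₀ hps0] at h1
    calc y ^ ps ≤ _ := h1
      _ = _ := by ring
  refine ⟨by rw [abs_of_nonneg hy]; exact le_max_of_le_left hyY, le_max_of_le_right ?_⟩
  refine le_max_of_rpow_le_add_mul_rpow (by positivity) zero_le_one hq ?_
  have h1 : |z| ^ q / q ≤ |E| + δ * Y * |z| := by
    have : δ * y * |z| ≤ δ * Y * |z| := by gcongr
    linarith
  rw [div_le_iff₀ (by linarith)] at h1
  rw [Real.rpow_one]
  linarith

theorem hasDerivAt_yf {u : ℝ → ℝ} {δ t : ℝ} (hu : DifferentiableAt ℝ u (Real.exp t)) :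
    HasDerivAt (yf u δ) (δ * yf u δ t + Real.exp ((1 + δ) * t) * deriv u (Real.exp t)) t := by
  have h1 : HasDerivAt (fun t : ℝ => Real.exp (δ * t)) (Real.exp (δ * t) * (δ * 1)) t :=
    ((hasDerivAt_id t).const_mul δ).exp
  refine (h1.mul (hu.hasDerivAt.comp t (Real.hasDerivAt_exp t))).congr_deriv ?_
  simp only [yf, Function.comp_apply]
  rw [show (1 + δ) * t = δ * t + t by ring, Real.exp_add]
  ring

theorem hasDerivAt_zf {n p a b μ ps δ t : ℝ} {u : ℝ → ℝ}
    (hδ : δ * p = n - (a + 1) * p) (hps : ps * (δ + b) = n) (hu : 0 < u (Real.exp t))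
    (hode : HasDerivAt (fun s : ℝ => s ^ (n - 1 - a * p) * |deriv u s| ^ (p - 2) * deriv u s)
      (-(Real.exp t ^ (n - 1) * (μ * u (Real.exp t) ^ (p - 1) / Real.exp t ^ ((a + 1) * p) +
        u (Real.exp t) ^ (ps - 1) / Real.exp t ^ (b * ps)))) (Real.exp t)) :
    HasDerivAt (zf u δ p)
      (-δ * zf u δ p t - yf u δ t ^ (ps - 1) - μ * yf u δ t ^ (p - 1)) t := by
  have hz : ∀ t, zf u δ p t = Real.exp (-δ * t) * (Real.exp t ^ (n - 1 - a * p) *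
      |deriv u (Real.exp t)| ^ (p - 2) * deriv u (Real.exp t)) := by
    intro t
    rw [zf, ← Real.exp_mul, ← mul_assoc, ← mul_assoc, ← Real.exp_add]
    congr 3
    linear_combination t * hδ
  have h1 : HasDerivAt (fun t : ℝ => Real.exp (-δ * t)) (Real.exp (-δ * t) * (-δ * 1)) t :=
    ((hasDerivAt_id t).const_mul (-δ)).exp
  rw [hz t, funext hz]
  refine (h1.mul (hode.comp t (Real.hasDerivAt_exp t))).congr_deriv ?_
  have e1 : Real.exp (-δ * t) * (Real.exp t ^ (n - 1) / Real.exp t ^ ((a + 1) * p) * Real.exp t) =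
      Real.exp (δ * t) ^ (p - 1) := by
    simp only [← Real.exp_mul, ← Real.exp_sub, ← Real.exp_add]
    congr 1
    linear_combination -t * hδ
  have e2 : Real.exp (-δ * t) * (Real.exp t ^ (n - 1) / Real.exp t ^ (b * ps) * Real.exp t) =
      Real.exp (δ * t) ^ (ps - 1) := by
    simp only [← Real.exp_mul, ← Real.exp_sub, ← Real.exp_add]
    congr 1
    linear_combination -t * hps
  simp only [yf, Function.comp_apply]
  rw [Real.mul_rpow (Real.exp_pos _).le hu.le, Real.mul_rpow (Real.exp_pos _).le hu.le, ← e1, ← e2]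
  ring

/-- Lemma 3.1: for a positive radial solution `u ∈ 𝔇` of the radial
Euler–Lagrange ODE, the functions `y` and `z` are bounded on `ℝ`. -/
theorem y_z_bounded (N : ℕ) (p a b μ ps δ : ℝ)
    (hp : 1 < p) (hpN : p < N) (ha : 0 ≤ a) (ha' : a < ((N : ℝ) - p) / p)
    (hb : a ≤ b) (hb' : b < a + 1)
    (hps : ps = (N : ℝ) * p / ((N : ℝ) - (a + 1 - b) * p))
    (hδ : δ = ((N : ℝ) - (a + 1) * p) / p)
    (hμ : 0 < μ) (hμ' : μ < δ ^ p)
    (u : ℝ → ℝ)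
    (hpos : ∀ r ∈ Ioi (0 : ℝ), 0 < u r)
    (hdiff : ∀ r ∈ Ioi (0 : ℝ), DifferentiableAt ℝ u r)
    (hode : ∀ r ∈ Ioi (0 : ℝ),
      HasDerivAt (fun s : ℝ => s ^ ((N : ℝ) - 1 - a * p) * |deriv u s| ^ (p - 2) * deriv u s)
        (-(r ^ ((N : ℝ) - 1) *
          (μ * u r ^ (p - 1) / r ^ ((a + 1) * p) + u r ^ (ps - 1) / r ^ (b * ps)))) r)
    (hmem : MemD N p a (fun x => u ‖x‖)) :
    ∃ M : ℝ, ∀ t : ℝ, |yf u δ t| ≤ M ∧ |zf u δ p t| ≤ M := by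
  have hp0 : 0 < p := by linarith
  have hδ0 : 0 < δ := by
    rw [lt_div_iff₀ hp0] at ha'
    rw [hδ]
    exact div_pos (by linarith) hp0
  have hδp : δ * p = N - (a + 1) * p := by
    rw [hδ]
    field_simp
  have hden : 0 < (N : ℝ) - (a + 1 - b) * p := by nlinarith
  have hps' : ps * (δ + b) = N := by
    rw [hps, div_mul_eq_mul_div, div_eq_iff hden.ne']
    linear_combination (N : ℝ) * hδp
  have hpps : p < ps := by
    rw [hps, lt_div_iff₀ hden]
    nlinarith [mul_pos (mul_pos (sub_pos.2 hb') hp0) hp0]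
  have hy0 : ∀ t, 0 < yf u δ t := fun t => mul_pos (Real.exp_pos _) (hpos _ (Real.exp_pos t))
  have hV : ∀ t, HasDerivAt (fun t => hamiltonian p μ ps δ (yf u δ t) (zf u δ p t)) 0 t := by
    intro t
    have hr : Real.exp t ∈ Ioi (0 : ℝ) := Real.exp_pos t
    refine hasDerivAt_hamiltonian hp (by linarith) (hy0 t).ne' (hasDerivAt_yf (hdiff _ hr))
      (hasDerivAt_zf hδp hps' (hpos _ hr) (hode _ hr)) ?_
    rw [zf, mul_right_comm (1 + δ)]
    exact abs_rpow_conj_sub_two_mul hp _ _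
  obtain ⟨M, hM⟩ := exists_bound_of_hamiltonian_eq hp hpps hδ0 hμ
    (hamiltonian p μ ps δ (yf u δ 0) (zf u δ p 0))
  exact ⟨M, fun t => hM _ _ (hy0 t).le (is_const_of_deriv_eq_zero
    (fun t => (hV t).differentiableAt) (fun t => (hV t).deriv) t 0)⟩
end
end
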